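/- (BEST theorem) If G is a finite strongly connected directed multigraph in which every vertex has indegree equal to outdegree, then the number of Eulerian tours of G starting with a fixed edge e with tail w equals κ_w · Π_{v∈V} (d_v − 1)!, where d_v is the outdegree of v and κ_w is the number of spanning trees of G oriented toward w. -/

import Mathlib

open Finset

structure Multigraph (V E : Type) where
  tail : E → V
  head : E → V

namespace Multigraph

variable {V E : Type} [Fintype V] [Fintype E] [DecidableEq V] [DecidableEq E]

/-- Outdegree of a vertex. -/
def outdeg (G : Multigraph V E) (v : V) : ℕ :=
  (Finset.univ.filter (fun e => G.tail e = v)).card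

/-- Indegree of a vertex. -/
def indeg (G : Multigraph V E) (v : V) : ℕ :=
  (Finset.univ.filter (fun e => G.head e = v)).card

/-- Number of edges from `u` to `v`. -/
def edgeCount (G : Multigraph V E) (u v : V) : ℕ :=
  (Finset.univ.filter (fun e => G.tail e = u ∧ G.head e = v)).card

/-- Directed graph Laplacian: `Δ u v = d_v δ_{uv} − d_{vu}`. -/
def laplacian (G : Multigraph V E) : Matrix V V ℤ :=
  fun u v => (if u = v then (G.outdeg v : ℤ) else 0) - (G.edgeCount v u : ℤ)

def Adj (G : Multigraph V E) (u v : V) : Prop := ∃ e, G.tail e = u ∧ G.head e = v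

/-- Strong connectivity: every vertex reaches every other by a directed path. -/
def StronglyConnected (G : Multigraph V E) : Prop :=
  ∀ u v : V, Relation.ReflTransGen G.Adj u v

/-- A list of edges forms a walk: consecutive edges are incident. -/
def IsWalk (G : Multigraph V E) : List E → Prop
  | [] => True
  | [_] => True
  | e :: f :: rest => G.head e = G.tail f ∧ G.IsWalk (f :: rest)

/-- A nonempty walk that returns to its starting vertex. -/
def IsClosedWalk (G : Multigraph V E) (w : List E) : Prop :=
  w ≠ [] ∧ G.IsWalk w ∧ w.getLast?.map G.head = w.head?.map G.tail

/-- The walk starts at vertex `v`. -/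
def StartsAt (G : Multigraph V E) (w : List E) (v : V) : Prop :=
  w.head?.map G.tail = some v

/-- A π-Eulerian tour: closed walk using each edge `e` exactly `π (tail e)` times. -/
def IsPiEulerian (G : Multigraph V E) (π : V → ℕ) (w : List E) : Prop :=
  G.IsClosedWalk w ∧ ∀ e : E, w.count e = π (G.tail e)

/-- An Eulerian tour: closed walk using each edge exactly once. -/
def IsEulerian (G : Multigraph V E) (w : List E) : Prop :=
  G.IsClosedWalk w ∧ ∀ e : E, w.count e = 1

/-- A multi-Eulerian tour: closed walk using each edge at least once, and edges
with the same tail equally often. -/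
def IsMultiEulerian (G : Multigraph V E) (w : List E) : Prop :=
  G.IsClosedWalk w ∧ (∀ e : E, 1 ≤ w.count e) ∧
  ∀ e f : E, G.tail e = G.tail f → w.count e = w.count f

/-- A spanning tree oriented toward `w`: every vertex other than `w` has exactly one
outgoing edge, `w` has none, and every vertex reaches `w` inside the subgraph. -/
def IsTreeTo (G : Multigraph V E) (w : V) (T : Finset E) : Prop :=
  (∀ v, v ≠ w → (T.filter (fun e => G.tail e = v)).card = 1) ∧
  (∀ e ∈ T, G.tail e ≠ w) ∧
  ∀ v : V, Relation.ReflTransGen (fun a b => ∃ e ∈ T, G.tail e = a ∧ G.head e = b) v w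

/-- Number of spanning trees oriented toward `w`. -/
noncomputable def treeCount (G : Multigraph V E) (w : V) : ℕ :=
  Nat.card {T : Finset E // G.IsTreeTo w T}

end Multigraph

namespace Multigraph

/-- The list of edges `l` is a directed path from `u` to `w`, edges being traversed in order. -/
def PathTo {V E : Type} (G : Multigraph V E) (w : V) : V → List E → Prop
  | u, [] => u = w
  | u, e :: l => G.tail e = u ∧ G.PathTo w (G.head e) l

section

variable {V E : Type}

/-- A tree oriented toward `w` inside the edge set `S`, spanning the tails of the edges of `S`. -/
def IsTreeIn (G : Multigraph V E) (w : V) (S T : Finset E) : Prop :=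
  T ⊆ S ∧ (∀ f ∈ S, G.tail f ≠ w → ∃! g, g ∈ T ∧ G.tail g = G.tail f) ∧
  (∀ g ∈ T, G.tail g ≠ w) ∧
  ∀ f ∈ S, Relation.ReflTransGen (fun a b => ∃ g ∈ T, G.tail g = a ∧ G.head g = b) (G.tail f) w

open Classical in
/-- The trees oriented toward `w` inside the edge set `S`. -/
noncomputable def treesIn (G : Multigraph V E) (w : V) (S : Finset E) : Finset (Finset E) :=
  S.powerset.filter (G.IsTreeIn w S)

theorem mem_treesIn (G : Multigraph V E) (w : V) (S T : Finset E) :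
    T ∈ G.treesIn w S ↔ G.IsTreeIn w S T := by
  classical
  simp only [treesIn, mem_filter, mem_powerset, and_iff_right_iff_imp]
  exact fun h => h.1

theorem treesIn_empty (G : Multigraph V E) (w : V) : G.treesIn w ∅ = {∅} := by
  ext T
  rw [mem_treesIn, mem_singleton]
  constructor
  · exact fun h => subset_empty.1 h.1
  · rintro rfl
    simp [IsTreeIn]

theorem treesIn_eq_empty (G : Multigraph V E) {w : V} {S : Finset E} (hS : S.Nonempty)
    (hout : ∀ f ∈ S, G.tail f ≠ w) (hin : ∀ f ∈ S, G.head f ≠ w) : G.treesIn w S = ∅ := by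
  rw [eq_empty_iff_forall_notMem]
  intro T hT
  obtain ⟨h1, -, -, h4⟩ := (G.mem_treesIn _ _ _).1 hT
  obtain ⟨f, hf⟩ := hS
  rcases Relation.ReflTransGen.cases_tail (h4 f hf) with h | ⟨b, -, g, hg, -, h⟩
  · exact hout f hf h.symm
  · exact hin g (h1 hg) h

variable [DecidableEq E]

/-- A trail from `u` to `w` using every edge of `S` exactly once, and no other edge. -/
def IsTrail (G : Multigraph V E) (w u : V) (S : Finset E) (l : List E) : Prop :=
  G.PathTo w u l ∧ ∀ f, l.count f = if f ∈ S then 1 else 0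

theorem isTrail_cons (G : Multigraph V E) (w u : V) (S : Finset E) (e : E) (l : List E) :
    G.IsTrail w u S (e :: l) ↔
      (e ∈ S ∧ G.tail e = u) ∧ G.IsTrail w (G.head e) (S.erase e) l := by
  constructor
  · rintro ⟨⟨h1, h2⟩, h3⟩
    have he : e ∈ S := by
      by_contra h
      have := h3 e
      simp [h] at this
    refine ⟨⟨he, h1⟩, h2, fun f => ?_⟩
    have := h3 f
    rw [List.count_cons] at this
    by_cases hf : f = e
    · subst hf
      simp_all
    · simpa [hf, Ne.symm hf] using this
  · rintro ⟨⟨he, h1⟩, h2, h3⟩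
    refine ⟨⟨h1, h2⟩, fun f => ?_⟩
    have := h3 f
    rw [List.count_cons]
    by_cases hf : f = e
    · subst hf
      simp_all
    · simpa [hf, Ne.symm hf] using this

theorem IsTrail.nodup {G : Multigraph V E} {w u : V} {S : Finset E} {l : List E}
    (h : G.IsTrail w u S l) : l.Nodup := by
  rw [List.nodup_iff_count_le_one]
  intro f
  rw [h.2 f]
  split <;> omega

instance finite_isTrail [Fintype E] (G : Multigraph V E) (w u : V) (S : Finset E) :
    Finite {l : List E // G.IsTrail w u S l} :=
  Finite.of_injective (β := {l : List E // l.Nodup}) (fun l => ⟨l.1, l.2.nodup⟩)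
    fun _ _ h => Subtype.ext (congrArg (fun x => x.1) h)

/-- A trail through a nonempty edge set is a first edge followed by a trail through the rest. -/
def trailEquiv (G : Multigraph V E) (w u : V) (S : Finset E) (hS : S.Nonempty) :
    {l : List E // G.IsTrail w u S l} ≃
      Σ e : {e : E // e ∈ S ∧ G.tail e = u},
        {l : List E // G.IsTrail w (G.head e.1) (S.erase e.1) l} where
  toFun
    | ⟨[], h⟩ => absurd hS (by
        rintro ⟨f, hf⟩
        have := h.2 f
        simp [hf] at this)
    | ⟨e :: l, h⟩ => ⟨⟨e, ((G.isTrail_cons w u S e l).1 h).1⟩,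
        ⟨l, ((G.isTrail_cons w u S e l).1 h).2⟩⟩
  invFun x := ⟨x.1.1 :: x.2.1, (G.isTrail_cons w u S _ _).2 ⟨x.1.2, x.2.2⟩⟩
  left_inv := by
    rintro ⟨l, h⟩
    cases l with
    | nil =>
      obtain ⟨f, hf⟩ := hS
      have := h.2 f
      simp [hf] at this
    | cons e l => rfl
  right_inv _ := rfl

theorem card_isTrail [Fintype E] [DecidableEq V] (G : Multigraph V E) (w u : V) (S : Finset E)
    (hS : S.Nonempty) :
    Nat.card {l : List E // G.IsTrail w u S l} =
      ∑ e ∈ S with G.tail e = u,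
        Nat.card {l : List E // G.IsTrail w (G.head e) (S.erase e) l} := by
  rw [Nat.card_congr (G.trailEquiv w u S hS), Nat.card_sigma]
  exact (Finset.sum_subtype _ (fun _ => mem_filter)
    fun e => Nat.card {l : List E // G.IsTrail w (G.head e) (S.erase e) l}).symm

theorem card_isTrail_empty (G : Multigraph V E) (w : V) :
    Nat.card {l : List E // G.IsTrail w w ∅ l} = 1 := by
  rw [Nat.card_eq_one_iff_unique]
  refine ⟨⟨fun a b => Subtype.ext ?_⟩, ⟨⟨[], rfl, by simp⟩⟩⟩
  have key : ∀ l : List E, G.IsTrail w w ∅ l → l = [] := by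
    rintro (_ | ⟨e, l⟩) h
    · rfl
    · simpa using ((G.isTrail_cons _ _ _ _ _).1 h).1.1
  rw [key _ a.2, key _ b.2]

theorem treesIn_erase_of_tail_eq (G : Multigraph V E) {w : V} {S : Finset E} {e : E}
    (hw : G.tail e = w) : G.treesIn w (S.erase e) = G.treesIn w S := by
  ext T
  rw [mem_treesIn, mem_treesIn]
  constructor
  · rintro ⟨h1, h2, h3, h4⟩
    refine ⟨h1.trans (erase_subset _ _), fun f hf hfw => h2 f ?_ hfw, h3, fun f hf => ?_⟩
    · exact mem_erase.2 ⟨fun h => hfw (h ▸ hw), hf⟩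
    · by_cases hfe : f = e
      · rw [hfe, hw]
      · exact h4 f (mem_erase.2 ⟨hfe, hf⟩)
  · rintro ⟨h1, h2, h3, h4⟩
    exact ⟨fun g hg => mem_erase.2 ⟨fun h => h3 g hg (h ▸ hw), h1 hg⟩,
      fun f hf => h2 f (mem_of_mem_erase hf), h3, fun f hf => h4 f (mem_of_mem_erase hf)⟩

theorem treesIn_erase_of_ne (G : Multigraph V E) {w : V} {S : Finset E} {e e' : E}
    (he' : e' ∈ S) (hne : e' ≠ e) (ht : G.tail e' = G.tail e) :
    G.treesIn w (S.erase e) = (G.treesIn w S).filter (fun T => e ∉ T) := by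
  ext T
  rw [mem_filter, mem_treesIn, mem_treesIn]
  constructor
  · rintro ⟨h1, h2, h3, h4⟩
    have he : e ∉ T := fun h => by simpa using h1 h
    have key : ∀ f ∈ S, ∃ f' ∈ S.erase e, G.tail f' = G.tail f := by
      intro f hf
      by_cases hfe : f = e
      · exact ⟨e', mem_erase.2 ⟨hne, he'⟩, hfe ▸ ht⟩
      · exact ⟨f, mem_erase.2 ⟨hfe, hf⟩, rfl⟩
    refine ⟨⟨h1.trans (erase_subset _ _), fun f hf hfw => ?_, h3, fun f hf => ?_⟩, he⟩
    · obtain ⟨f', hf', h⟩ := key f hf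
      exact h ▸ h2 f' hf' (h ▸ hfw)
    · obtain ⟨f', hf', h⟩ := key f hf
      exact h ▸ h4 f' hf'
  · rintro ⟨⟨h1, h2, h3, h4⟩, he⟩
    exact ⟨fun g hg => mem_erase.2 ⟨fun h => he (h ▸ hg), h1 hg⟩,
      fun f hf => h2 f (mem_of_mem_erase hf), h3, fun f hf => h4 f (mem_of_mem_erase hf)⟩

theorem sum_card_treesIn_erase [DecidableEq V] (G : Multigraph V E) {w u : V} {S : Finset E}
    (huw : u ≠ w) (hd : 2 ≤ #{e ∈ S | G.tail e = u}) :
    ∑ e ∈ S with G.tail e = u, #(G.treesIn w (S.erase e)) =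
      #(G.treesIn w S) * (#{e ∈ S | G.tail e = u} - 1) := by
  have h1 : ∀ e ∈ S.filter (fun e => G.tail e = u), #(G.treesIn w (S.erase e)) =
      ∑ T ∈ G.treesIn w S, if e ∉ T then 1 else 0 := by
    intro e he
    obtain ⟨e', he', hne⟩ := Finset.exists_mem_ne hd e
    rw [mem_filter] at he he'
    rw [G.treesIn_erase_of_ne he'.1 hne (he'.2.trans he.2.symm), card_filter]
  rw [sum_congr rfl h1, sum_comm, card_eq_sum_ones, sum_mul]
  refine sum_congr rfl fun T hT => ?_
  obtain ⟨hTS, h2, -, -⟩ := (G.mem_treesIn w S T).1 hT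
  obtain ⟨f, hf⟩ := card_pos.1 (by omega : 0 < #{e ∈ S | G.tail e = u})
  rw [mem_filter] at hf
  obtain ⟨g, hg, hg'⟩ := h2 f hf.1 (hf.2 ▸ huw)
  rw [← card_filter, one_mul]
  have : (S.filter (fun e => G.tail e = u)).filter (fun e => e ∉ T) =
      (S.filter (fun e => G.tail e = u)).erase g := by
    ext x
    simp only [mem_filter, mem_erase]
    constructor
    · rintro ⟨h, hx⟩
      exact ⟨fun hxg => hx (hxg ▸ hg.1), h⟩
    · rintro ⟨hxg, h⟩
      exact ⟨h, fun hx => hxg (hg' x ⟨hx, h.2.trans hf.2.symm⟩)⟩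
  rw [this, card_erase_of_mem (mem_filter.2 ⟨hTS hg.1, hg.2.trans hf.2⟩)]

/-- Removing the only edge at a vertex without incoming edges does not change the number of
trees. -/
theorem card_treesIn_erase_of_leaf (G : Multigraph V E) {w : V} {S : Finset E} {e : E}
    (he : e ∈ S) (hew : G.tail e ≠ w) (hout : ∀ f ∈ S, G.tail f = G.tail e → f = e)
    (hin : ∀ f ∈ S, G.head f ≠ G.tail e)
    (hhead : G.head e ≠ w → ∃ f ∈ S, G.tail f = G.head e) :
    #(G.treesIn w (S.erase e)) = #(G.treesIn w S) := by
  refine card_bij' (fun T _ => insert e T) (fun T _ => T.erase e) ?_ ?_ ?_ ?_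
  · intro T hT
    rw [mem_treesIn] at hT ⊢
    obtain ⟨h1, h2, h3, h4⟩ := hT
    have hmono : ∀ {a}, Relation.ReflTransGen
        (fun a b => ∃ g ∈ T, G.tail g = a ∧ G.head g = b) a w →
        Relation.ReflTransGen
        (fun a b => ∃ g ∈ insert e T, G.tail g = a ∧ G.head g = b) a w :=
      fun h => Relation.ReflTransGen.mono (fun a b ⟨g, hg, h⟩ => ⟨g, mem_insert_of_mem hg, h⟩) _ _ h
    refine ⟨?_, ?_, ?_, ?_⟩
    · exact insert_subset he (h1.trans (erase_subset _ _))
    · intro f hf hfw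
      by_cases hfe : f = e
      · subst hfe
        refine ⟨f, ⟨mem_insert_self _ _, rfl⟩, ?_⟩
        rintro g ⟨hg, hgf⟩
        rcases mem_insert.1 hg with rfl | hg
        · rfl
        · exact hout g (mem_of_mem_erase (h1 hg)) hgf
      · obtain ⟨g, hg, hg'⟩ := h2 f (mem_erase.2 ⟨hfe, hf⟩) hfw
        refine ⟨g, ⟨mem_insert_of_mem hg.1, hg.2⟩, ?_⟩
        rintro x ⟨hx, hxf⟩
        rcases mem_insert.1 hx with rfl | hx
        · exact absurd (hout f hf hxf.symm) hfe
        · exact hg' x ⟨hx, hxf⟩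
    · intro g hg
      rcases mem_insert.1 hg with rfl | hg
      · exact hew
      · exact h3 g hg
    · intro f hf
      by_cases hfe : f = e
      · subst hfe
        refine Relation.ReflTransGen.head ⟨f, mem_insert_self _ _, rfl, rfl⟩ ?_
        by_cases hh : G.head f = w
        · rw [hh]
        · obtain ⟨f', hf', h⟩ := hhead hh
          rw [← h]
          refine hmono (h4 f' (mem_erase.2 ⟨?_, hf'⟩))
          rintro rfl
          exact hin _ hf' h.symm
      · exact hmono (h4 f (mem_erase.2 ⟨hfe, hf⟩))
  · intro T hT
    rw [mem_treesIn] at hT ⊢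
    obtain ⟨h1, h2, h3, h4⟩ := hT
    refine ⟨erase_subset_erase _ h1, ?_, fun g hg => h3 g (mem_of_mem_erase hg), ?_⟩
    · intro f hf hfw
      obtain ⟨hfe, hfS⟩ := mem_erase.1 hf
      obtain ⟨g, hg, hg'⟩ := h2 f hfS hfw
      refine ⟨g, ⟨mem_erase.2 ⟨?_, hg.1⟩, hg.2⟩, ?_⟩
      · rintro rfl
        exact hfe (hout f hfS hg.2.symm)
      · rintro x ⟨hx, hxf⟩
        exact hg' x ⟨mem_of_mem_erase hx, hxf⟩
    · intro f hf
      obtain ⟨hfe, hf⟩ := mem_erase.1 hf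
      have key : ∀ a, Relation.ReflTransGen
          (fun a b => ∃ g ∈ T, G.tail g = a ∧ G.head g = b) a w → a ≠ G.tail e →
          Relation.ReflTransGen
          (fun a b => ∃ g ∈ T.erase e, G.tail g = a ∧ G.head g = b) a w := by
        intro a ha
        induction ha using Relation.ReflTransGen.head_induction_on with
        | refl => exact fun _ => .refl
        | head hab _ ih =>
          intro hae
          obtain ⟨g, hg, rfl, rfl⟩ := hab
          exact .head ⟨g, mem_erase.2 ⟨fun h => hae (h ▸ rfl), hg⟩, rfl, rfl⟩ (ih (hin g (h1 hg)))
      exact key _ (h4 f hf) fun h => hfe (hout f hf h)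
  · intro T hT
    have h1 := ((G.mem_treesIn _ _ _).1 hT).1
    exact erase_insert fun h => by simpa using h1 h
  · intro T hT
    obtain ⟨h1, h2, -, -⟩ := (G.mem_treesIn _ _ _).1 hT
    obtain ⟨g, hg, -⟩ := h2 e he hew
    exact insert_erase (hout g (h1 hg.1) hg.2 ▸ hg.1)

variable [DecidableEq V]

/-- The degree conditions satisfied by the edge set of a trail from `u` to `w`. -/
def IsTrailBalanced (G : Multigraph V E) (w u : V) (S : Finset E) : Prop :=
  ∀ v, #{e ∈ S | G.tail e = v} + (if v = w then 1 else 0) =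
    #{e ∈ S | G.head e = v} + (if v = u then 1 else 0)

theorem card_filter_erase_add {S : Finset E} {e : E} (he : e ∈ S) (f : E → V) (v : V) :
    #{x ∈ S.erase e | f x = v} + (if v = f e then 1 else 0) = #{x ∈ S | f x = v} := by
  rw [filter_erase]
  split_ifs with h
  · exact card_erase_add_one (mem_filter.2 ⟨he, h.symm⟩)
  · rw [erase_eq_of_notMem, add_zero]
    exact fun h' => h (mem_filter.1 h').2.symm

theorem IsTrailBalanced.erase {G : Multigraph V E} {w : V} {S : Finset E} {e : E}
    (h : G.IsTrailBalanced w (G.tail e) S) (he : e ∈ S) :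
    G.IsTrailBalanced w (G.head e) (S.erase e) := by
  intro v
  have h1 := card_filter_erase_add he G.tail v
  have h2 := card_filter_erase_add he G.head v
  have h3 := h v
  omega

variable [Fintype V]

/-- The number of ways to order, at every vertex, the outgoing edges in `S` that are not
prescribed by a given tree oriented toward `w`. -/
def orderings (G : Multigraph V E) (w : V) (S : Finset E) : ℕ :=
  ∏ v, if v = w then (#{e ∈ S | G.tail e = v}).factorial
    else (#{e ∈ S | G.tail e = v} - 1).factorial

theorem orderings_erase (G : Multigraph V E) {w : V} {S : Finset E} {e : E} (he : e ∈ S) :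
    G.orderings w S = (if G.tail e = w then #{x ∈ S | G.tail x = G.tail e}
      else if #{x ∈ S | G.tail x = G.tail e} = 1 then 1
      else #{x ∈ S | G.tail x = G.tail e} - 1) * G.orderings w (S.erase e) := by
  unfold orderings
  rw [← mul_prod_erase univ _ (mem_univ (G.tail e)),
    ← mul_prod_erase univ (fun v => if v = w then (#{x ∈ S.erase e | G.tail x = v}).factorial
      else (#{x ∈ S.erase e | G.tail x = v} - 1).factorial) (mem_univ (G.tail e)), ← mul_assoc]
  congr 1
  · have h := card_filter_erase_add he G.tail (G.tail e)
    rw [if_pos rfl] at h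
    rw [← h]
    generalize #{x ∈ S.erase e | G.tail x = G.tail e} = n
    split_ifs with h1 h2
    · exact Nat.factorial_succ n
    · obtain rfl : n = 0 := by omega
      rfl
    · obtain ⟨m, rfl⟩ : ∃ m, n = m + 1 := ⟨n - 1, by omega⟩
      exact Nat.factorial_succ m
  · refine prod_congr rfl fun v hv => ?_
    have h := card_filter_erase_add he G.tail v
    rw [if_neg (ne_of_mem_erase hv), add_zero] at h
    rw [h]

theorem card_isTrail_eq [Fintype E] (G : Multigraph V E) (w : V) (S : Finset E) (u : V)
    (hb : G.IsTrailBalanced w u S) :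
    Nat.card {l : List E // G.IsTrail w u S l} = #(G.treesIn w S) * G.orderings w S := by
  induction S using Finset.strongInduction generalizing u with
  | H S ih =>
  rcases S.eq_empty_or_nonempty with rfl | hS
  · obtain rfl : w = u := by
      have := hb w
      by_contra h
      simp [h] at this
    rw [card_isTrail_empty, treesIn_empty]
    simp [orderings]
  rw [G.card_isTrail w u S hS]
  have step : ∀ e ∈ S.filter (fun e => G.tail e = u),
      Nat.card {l : List E // G.IsTrail w (G.head e) (S.erase e) l} =
        #(G.treesIn w (S.erase e)) * G.orderings w (S.erase e) := by
    intro e he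
    obtain ⟨heS, rfl⟩ := mem_filter.1 he
    exact ih _ (erase_ssubset heS) _ (hb.erase heS)
  rw [sum_congr rfl step]
  have hbu := hb u
  by_cases huw : u = w
  · subst huw
    rcases (S.filter (fun e => G.tail e = u)).eq_empty_or_nonempty with h0 | ⟨e₀, he₀⟩
    · have h0' : S.filter (fun e => G.head e = u) = ∅ := by
        rw [← card_eq_zero]
        rw [h0] at hbu
        simpa using hbu.symm
      rw [h0, G.treesIn_eq_empty hS (by simpa [filter_eq_empty_iff] using h0)
        (by simpa [filter_eq_empty_iff] using h0')]
      simp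
    · have hn : #{e ∈ S | G.tail e = u} ≠ 0 := (card_pos.2 ⟨e₀, he₀⟩).ne'
      have hterm : ∀ e ∈ S.filter (fun e => G.tail e = u),
          #(G.treesIn u (S.erase e)) * G.orderings u (S.erase e) =
            #(G.treesIn u S) * G.orderings u (S.erase e₀) := by
        intro e he
        obtain ⟨he, hu⟩ := mem_filter.1 he
        obtain ⟨he₀, hu₀⟩ := mem_filter.1 he₀
        have h1 := G.orderings_erase (w := u) he
        have h2 := G.orderings_erase (w := u) he₀
        rw [if_pos hu, hu] at h1
        rw [if_pos hu₀, hu₀] at h2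
        rw [G.treesIn_erase_of_tail_eq hu,
          Nat.eq_of_mul_eq_mul_left (Nat.pos_of_ne_zero hn) (h1.symm.trans h2)]
      obtain ⟨he₀, hu₀⟩ := mem_filter.1 he₀
      rw [sum_congr rfl hterm, sum_const, G.orderings_erase he₀, if_pos hu₀, hu₀, smul_eq_mul]
      ring
  · simp only [if_neg huw, if_true, add_zero] at hbu
    by_cases hd : #{e ∈ S | G.tail e = u} = 1
    · obtain ⟨e, he⟩ := card_eq_one.1 hd
      have hmem : e ∈ S ∧ G.tail e = u := by
        rw [← mem_filter (p := fun e => G.tail e = u), he]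
        exact mem_singleton_self e
      obtain ⟨heS, hu⟩ := hmem
      have hin : ∀ f ∈ S, G.head f ≠ G.tail e := by
        have : S.filter (fun e => G.head e = u) = ∅ := by
          rw [← card_eq_zero]
          omega
        simpa [filter_eq_empty_iff, hu] using this
      rw [he, sum_singleton, G.orderings_erase heS, if_neg (hu ▸ huw), hu, if_pos hd, one_mul]
      congr 1
      refine G.card_treesIn_erase_of_leaf heS (hu ▸ huw) ?_ hin ?_
      · intro f hf hfe
        rw [← mem_singleton, ← he]
        exact mem_filter.2 ⟨hf, hfe.trans hu⟩
      · intro hh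
        have h1 := hb (G.head e)
        rw [if_neg hh, if_neg (hu ▸ hin e heS)] at h1
        have h2 : 0 < #{f ∈ S | G.head f = G.head e} :=
          card_pos.2 ⟨e, mem_filter.2 ⟨heS, rfl⟩⟩
        obtain ⟨f, hf⟩ := card_pos.1 (by omega : 0 < #{f ∈ S | G.tail f = G.head e})
        exact ⟨f, mem_filter.1 hf⟩
    · have hd2 : 2 ≤ #{e ∈ S | G.tail e = u} := by omega
      obtain ⟨e₀, he₀⟩ := card_pos.1 (by omega : 0 < #{e ∈ S | G.tail e = u})
      have hfac : ∀ e ∈ S.filter (fun e => G.tail e = u),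
          G.orderings w S = (#{e ∈ S | G.tail e = u} - 1) * G.orderings w (S.erase e) := by
        intro e he
        obtain ⟨he, hu⟩ := mem_filter.1 he
        rw [G.orderings_erase he, if_neg (hu ▸ huw), hu, if_neg hd]
      have hterm : ∀ e ∈ S.filter (fun e => G.tail e = u),
          #(G.treesIn w (S.erase e)) * G.orderings w (S.erase e) =
            #(G.treesIn w (S.erase e)) * G.orderings w (S.erase e₀) := by
        intro e he
        rw [Nat.eq_of_mul_eq_mul_left (by omega) ((hfac e he).symm.trans (hfac e₀ he₀))]
      rw [sum_congr rfl hterm, ← sum_mul, G.sum_card_treesIn_erase huw hd2, hfac e₀ he₀, mul_assoc]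

end

theorem isWalk_cons_iff_pathTo {V E : Type} (G : Multigraph V E) (w : V) (e : E) (l : List E) :
    (G.IsWalk (e :: l) ∧ (e :: l).getLast?.map G.head = some w) ↔ G.PathTo w (G.head e) l := by
  induction l generalizing e with
  | nil => simp [IsWalk, PathTo]
  | cons f l ih =>
    rw [PathTo, ← ih f, IsWalk, List.getLast?_cons_cons, and_assoc, eq_comm]

variable {V E : Type}

theorem isEulerian_cons_iff [Fintype E] [DecidableEq E] (G : Multigraph V E) (e : E) (l : List E) :
    G.IsEulerian (e :: l) ↔ G.IsTrail (G.tail e) (G.head e) (univ.erase e) l := by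
  have h := G.isTrail_cons (G.tail e) (G.tail e) univ e l
  simp only [mem_univ, true_and] at h
  rw [← h, IsEulerian, IsClosedWalk, IsTrail, PathTo, List.head?_cons, Option.map_some,
    G.isWalk_cons_iff_pathTo]
  simp

/-- Eulerian tours starting with `e` correspond to trails through the other edges. -/
def eulerianEquiv [Fintype E] [DecidableEq E] (G : Multigraph V E) (e : E) :
    {l : List E // G.IsEulerian l ∧ l.head? = some e} ≃
      {l : List E // G.IsTrail (G.tail e) (G.head e) (univ.erase e) l} where
  toFun l := ⟨l.1.tail, by
    obtain ⟨l, hl, he⟩ := l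
    rw [← G.isEulerian_cons_iff, List.cons_head?_tail he]
    exact hl⟩
  invFun l := ⟨e :: l.1, (G.isEulerian_cons_iff e l.1).2 l.2, rfl⟩
  left_inv l := Subtype.ext (List.cons_head?_tail l.2.2)
  right_inv _ := rfl

theorem isTreeIn_univ_iff [Fintype E] [DecidableEq V] (G : Multigraph V E) (w : V)
    (hpos : ∀ v, ∃ e, G.tail e = v) (T : Finset E) :
    G.IsTreeIn w univ T ↔ G.IsTreeTo w T := by
  have hcard : ∀ v, #(T.filter (fun e => G.tail e = v)) = 1 ↔ ∃! g, g ∈ T ∧ G.tail g = v := by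
    intro v
    rw [card_eq_one_iff_existsUnique]
    simp only [mem_filter]
  simp only [IsTreeIn, IsTreeTo, hcard, subset_univ, true_and, mem_univ, forall_const]
  refine and_congr ?_ (and_congr Iff.rfl ?_)
  · exact ⟨fun h v => by obtain ⟨f, rfl⟩ := hpos v; exact h f, fun h f => h _⟩
  · exact ⟨fun h v => by obtain ⟨f, rfl⟩ := hpos v; exact h f, fun h f => h _⟩

theorem StronglyConnected.exists_tail_eq {G : Multigraph V E} (h : G.StronglyConnected) (e : E)
    (v : V) : ∃ f, G.tail f = v := by
  rcases (h v (G.tail e)).cases_head with h | ⟨_, ⟨f, hf, -⟩, -⟩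
  · exact ⟨e, h.symm⟩
  · exact ⟨f, hf⟩

end Multigraph

theorem stmt5 {V E : Type} [Fintype V] [Fintype E] [DecidableEq V] [DecidableEq E]
    (G : Multigraph V E) (hsc : G.StronglyConnected)
    (hbal : ∀ v : V, G.indeg v = G.outdeg v) (e : E) :
    Nat.card {l : List E // G.IsEulerian l ∧ l.head? = some e} =
      G.treeCount (G.tail e) * ∏ v : V, (G.outdeg v - 1).factorial := by
  have hb : G.IsTrailBalanced (G.tail e) (G.tail e) univ := fun v => by
    rw [show #{e | G.tail e = v} = #{e | G.head e = v} from (hbal v).symm]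
  rw [Nat.card_congr (G.eulerianEquiv e), G.card_isTrail_eq _ _ _ (hb.erase (mem_univ e)),
    G.treesIn_erase_of_tail_eq rfl]
  congr 1
  · rw [Multigraph.treeCount, Nat.subtype_card]
    intro T
    rw [G.mem_treesIn, G.isTreeIn_univ_iff _ (hsc.exists_tail_eq e)]
  · refine prod_congr rfl fun v _ => ?_
    have h := Multigraph.card_filter_erase_add (mem_univ e) G.tail v
    rw [Multigraph.outdeg, ← h]
    split_ifs <;> rfl
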